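/- arXiv:1912.01523 — 2 statements merged into one kernel-verified Lean document; each statement's English description precedes it below -/
import Mathlib

section
/- There exists a compact set P ⊆ ℝ² with P - P ⊇ S¹ and lower box dimension of P at most 2/3. -/
open Metric Filter Set Real
open scoped Topology Pointwise ENNReal

/-- Minimal number of balls of radius `r` needed to cover `F` (`⊤` if no finite cover). -/
noncomputable def coverN {E : Type*} [PseudoMetricSpace E] (r : ℝ) (F : Set E) : ℕ∞ :=
  ⨅ (S : Finset E) (_ : F ⊆ ⋃ x ∈ S, Metric.ball x r), (S.card : ℕ∞)

/-- Lower box (Minkowski) dimension. -/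
noncomputable def lowerBoxDim {E : Type*} [PseudoMetricSpace E] (F : Set E) : ℝ :=
  Filter.liminf (fun r : ℝ => Real.log ((coverN r F).toNat) / Real.log (1 / r)) (𝓝[>] 0)

/-- Upper box (Minkowski) dimension. -/
noncomputable def upperBoxDim {E : Type*} [PseudoMetricSpace E] (F : Set E) : ℝ :=
  Filter.limsup (fun r : ℝ => Real.log ((coverN r F).toNat) / Real.log (1 / r)) (𝓝[>] 0)

/-- Assouad dimension. -/
noncomputable def assouadDim {E : Type*} [PseudoMetricSpace E] (F : Set E) : ℝ :=
  sInf {s : ℝ | 0 ≤ s ∧ ∃ C > 0, ∀ x ∈ F, ∀ R > 0, ∀ r, 0 < r → r < R →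
    (((coverN r (Metric.closedBall x R ∩ F)).toNat : ℝ)) ≤ C * (R / r) ^ s}

namespace Dipole

/-- The scale denominators. -/
def nn (k : ℕ) : ℕ := 2 ^ (4 ^ k)

/-- Rounding down to multiples of `1/N`. -/
noncomputable def fl (N : ℕ) (t : ℝ) : ℝ := (⌊(N : ℝ) * t⌋₊ : ℝ) / N

/-- Unit circle parametrisation. -/
noncomputable def e (t : ℝ) : ℂ := Complex.exp (Complex.I * t)

/-- The displacement at stage `j`. -/
noncomputable def f (t : ℝ) (j : ℕ) : ℂ := e (fl (nn j) t) - e (fl (nn j ^ 2) t)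

/-- Partial sums of displacements. -/
noncomputable def S (k : ℕ) (t : ℝ) : ℂ := ∑ j ∈ Finset.range k, f t j

/-- Total displacement. -/
noncomputable def X (t : ℝ) : ℂ := ∑' j, f t j

lemma nn_pos (k : ℕ) : 0 < nn k := by unfold nn; positivity

lemma nn_succ (k : ℕ) : nn (k + 1) = nn k ^ 4 := by
  unfold nn; rw [← pow_mul, pow_succ]

lemma nn_dvd_sq {j k : ℕ} (h : j < k) : nn j ^ 2 ∣ nn k := by
  unfold nn
  rw [← pow_mul]
  apply pow_dvd_pow
  calc 4 ^ j * 2 ≤ 4 ^ j * 4 := by omega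
    _ = 4 ^ (j + 1) := by rw [pow_succ]
    _ ≤ 4 ^ k := Nat.pow_le_pow_right (by norm_num) h

lemma nn_growth (i k : ℕ) : nn k * 2 ^ i ≤ nn (i + k) := by
  unfold nn
  rw [← pow_add]
  apply Nat.pow_le_pow_right (by norm_num)
  induction i with
  | zero => simp
  | succ i ih =>
    have : 4 ^ (i + 1 + k) = 4 * 4 ^ (i + k) := by ring
    have h2 : 1 ≤ 4 ^ (i + k) := Nat.one_le_pow _ _ (by norm_num)
    omega

lemma fl_fl {N M : ℕ} (hM : 0 < M) (h : N ∣ M) (t : ℝ) : fl N (fl M t) = fl N t := by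
  obtain ⟨d, rfl⟩ := h
  have hN : 0 < N := Nat.pos_of_mul_pos_right hM
  have hd : 0 < d := Nat.pos_of_mul_pos_left hM
  have hN' : (N : ℝ) ≠ 0 := by positivity
  have hd' : (d : ℝ) ≠ 0 := by positivity
  have h1 : (N : ℝ) * fl (N * d) t = (⌊((N * d : ℕ) : ℝ) * t⌋₊ : ℝ) / d := by
    unfold fl; push_cast; field_simp
  have h2 : (N : ℝ) * t = (((N * d : ℕ) : ℝ) * t) / d := by
    push_cast; field_simp
  have h3 : ⌊(N : ℝ) * fl (N * d) t⌋₊ = ⌊(N : ℝ) * t⌋₊ := by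
    rw [h1, h2, Nat.floor_div_natCast, Nat.floor_div_natCast, Nat.floor_natCast]
  rw [fl, h3, fl]

lemma fl_le {N : ℕ} (hN : 0 < N) {t : ℝ} (ht : 0 ≤ t) : fl N t ≤ t := by
  have hN' : (0 : ℝ) < N := by positivity
  unfold fl
  rw [div_le_iff₀ hN', mul_comm]
  exact Nat.floor_le (by positivity)

lemma lt_fl {N : ℕ} (hN : 0 < N) (t : ℝ) : t < fl N t + 1 / N := by
  have hN' : (0 : ℝ) < N := by positivity
  unfold fl
  rw [← add_div, lt_div_iff₀ hN', mul_comm]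
  exact Nat.lt_floor_add_one _

lemma e_add (s t : ℝ) : e (s + t) = e s * e t := by
  unfold e; rw [← Complex.exp_add]; push_cast; ring_nf

lemma norm_e (t : ℝ) : ‖e t‖ = 1 := by
  unfold e; rw [mul_comm]; exact Complex.norm_exp_ofReal_mul_I t

lemma e_sub_one (t : ℝ) : ‖e t - 1‖ ≤ |t| := by
  unfold e; exact Real.norm_exp_I_mul_ofReal_sub_one_le

lemma e_lip (s t : ℝ) : ‖e s - e t‖ ≤ |s - t| := by
  have : e s - e t = e t * (e (s - t) - 1) := by
    rw [mul_sub, ← e_add]; ring_nf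
  rw [this, norm_mul, norm_e, one_mul]
  exact e_sub_one _

lemma fl_diff {N : ℕ} (hN : 0 < N) {t : ℝ} (ht : 0 ≤ t) :
    |fl N t - fl (N ^ 2) t| ≤ 1 / N := by
  have h1 := fl_le hN ht
  have h2 := lt_fl hN t
  have hN2 : 0 < N ^ 2 := by positivity
  have h3 := fl_le hN2 ht
  have h4 := lt_fl hN2 t
  have h5 : (1 : ℝ) / ((N ^ 2 : ℕ) : ℝ) ≤ 1 / N := by
    apply one_div_le_one_div_of_le (by positivity)
    exact_mod_cast Nat.le_self_pow (by norm_num) N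
  rw [abs_le]; constructor <;> linarith

lemma f_bound {t : ℝ} (ht : 0 ≤ t) (j : ℕ) : ‖f t j‖ ≤ 1 / nn j :=
  (e_lip _ _).trans (fl_diff (nn_pos j) ht)

lemma f_bound' {t : ℝ} (ht : 0 ≤ t) (i k : ℕ) :
    ‖f t (i + k)‖ ≤ (2 / (nn k : ℝ)) / 2 / 2 ^ i := by
  refine (f_bound ht _).trans ?_
  have h := nn_growth i k
  have hk := nn_pos k
  have h' : (nn k : ℝ) * 2 ^ i ≤ nn (i + k) := by exact_mod_cast h
  calc (1 : ℝ) / nn (i + k) ≤ 1 / ((nn k : ℝ) * 2 ^ i) :=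
        one_div_le_one_div_of_le (by positivity) h'
    _ = _ := by field_simp

lemma f_summable {t : ℝ} (ht : 0 ≤ t) : Summable (f t) :=
  Summable.of_norm_bounded (hasSum_geometric_two' (2 / (nn 0 : ℝ))).summable
    (fun i => f_bound' ht i 0)

lemma tail {t : ℝ} (ht : 0 ≤ t) (k : ℕ) : ‖X t - S k t‖ ≤ 2 / nn k := by
  have h := (f_summable ht).sum_add_tsum_nat_add k
  have : X t - S k t = ∑' i, f t (i + k) := by
    unfold X S; rw [← h]; ring
  rw [this]
  exact tsum_of_norm_bounded (hasSum_geometric_two' (2 / (nn k : ℝ))) (fun i => f_bound' ht i k)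

lemma S_fl (k M : ℕ) (hM : 0 < M) (h : ∀ j < k, nn j ^ 2 ∣ M) (t : ℝ) :
    S k (fl M t) = S k t := by
  unfold S f
  apply Finset.sum_congr rfl
  intro j hj
  have h1 := h j (Finset.mem_range.1 hj)
  rw [fl_fl hM h1, fl_fl hM ((Dvd.intro_left _ (by ring : nn j * nn j = nn j ^ 2)).trans h1)]

lemma tail_succ {t : ℝ} (ht : 0 ≤ t) (k : ℕ) : ‖X t - S (k + 1) t‖ ≤ 2 / (nn k : ℝ) ^ 3 := by
  refine (tail ht (k + 1)).trans ?_
  have hk := nn_pos k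
  apply div_le_div_of_nonneg_left (by norm_num) (by positivity)
  rw [nn_succ]
  exact_mod_cast Nat.pow_le_pow_right hk (by norm_num)

/-- Cover centres for the first kind of points. -/
noncomputable def C1 (k : ℕ) : Finset ℂ :=
  (Finset.range (10 * nn k ^ 2 + 1)).image fun m : ℕ => S (k + 1) ((m : ℝ) / (nn k ^ 2 : ℕ))

/-- Cover centres for the second kind of points. -/
noncomputable def C2 (k : ℕ) : Finset ℂ :=
  ((Finset.range (10 * nn k + 1)) ×ˢ (Finset.range (nn k))).image fun p : ℕ × ℕ =>
    S k ((p.1 : ℝ) / nn k) + e ((p.1 : ℝ) / nn k + (p.2 : ℝ) / (nn k : ℝ) ^ 3)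

lemma card_le (k : ℕ) : (C1 k ∪ C2 k).card ≤ 22 * nn k ^ 2 := by
  have hk := nn_pos k
  have h1 : (C1 k).card ≤ 10 * nn k ^ 2 + 1 :=
    Finset.card_image_le.trans (by simp)
  have h2 : (C2 k).card ≤ (10 * nn k + 1) * nn k :=
    Finset.card_image_le.trans (by simp)
  have h3 := Finset.card_union_le (C1 k) (C2 k)
  nlinarith

lemma floor_mem {N : ℕ} {t : ℝ} (ht' : t ≤ 10) :
    ⌊(N : ℝ) * t⌋₊ ∈ Finset.range (10 * N + 1) := by
  rw [Finset.mem_range, Nat.lt_succ_iff]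
  apply Nat.floor_le_of_le
  push_cast
  have : (0 : ℝ) ≤ N := by positivity
  nlinarith

lemma cov1 (k : ℕ) {t : ℝ} (ht : 0 ≤ t) (ht' : t ≤ 10) :
    ∃ c ∈ C1 k, dist (X t) c ≤ 4 / (nn k : ℝ) ^ 3 := by
  have hk := nn_pos k
  refine ⟨S (k + 1) (fl (nn k ^ 2) t), ?_, ?_⟩
  · exact Finset.mem_image.2 ⟨⌊((nn k ^ 2 : ℕ) : ℝ) * t⌋₊, floor_mem ht', rfl⟩
  · rw [S_fl _ _ (by positivity), dist_eq_norm]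
    · refine (tail_succ ht k).trans ?_
      gcongr; norm_num
    · intro j hj
      rcases Nat.lt_succ_iff_lt_or_eq.1 hj with h | h
      · exact (nn_dvd_sq h).trans (Dvd.intro_left _ (by ring : nn k * nn k = nn k ^ 2))
      · rw [h]

lemma cov2 (k : ℕ) {t : ℝ} (ht : 0 ≤ t) (ht' : t ≤ 10) :
    ∃ c ∈ C2 k, dist (X t + e t) c ≤ 4 / (nn k : ℝ) ^ 3 := by
  have hk := nn_pos k
  have hk' : (0 : ℝ) < nn k := by positivity
  have hb1 := fl_le (show 0 < nn k ^ 2 by positivity) ht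
  have hb2 := lt_fl (show 0 < nn k ^ 2 by positivity) t
  have hab := fl_diff hk ht
  set a := fl (nn k) t with ha
  set b := fl (nn k ^ 2) t with hb
  set u := t - b with hu
  have hu0 : 0 ≤ u := by linarith
  have hu1 : u < 1 / (nn k : ℝ) ^ 2 := by push_cast at hb2; linarith
  set l := ⌊((nn k ^ 3 : ℕ) : ℝ) * u⌋₊ with hl
  set v := fl (nn k ^ 3) u with hv
  have hv1 := fl_le (show 0 < nn k ^ 3 by positivity) hu0
  have hv2 := lt_fl (show 0 < nn k ^ 3 by positivity) u
  rw [← hv] at hv1 hv2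
  push_cast at hv2
  refine ⟨S k a + e (a + v), ?_, ?_⟩
  · refine Finset.mem_image.2 ⟨(⌊(nn k : ℝ) * t⌋₊, l), ?_, ?_⟩
    · refine Finset.mem_product.2 ⟨floor_mem ht', ?_⟩
      rw [Finset.mem_range]
      apply (Nat.floor_lt (by positivity)).2
      push_cast
      rw [lt_div_iff₀ (by positivity)] at hu1
      nlinarith
    · simp only [ha, hv, fl, hl]; push_cast; rfl
  · rw [ha, S_fl k _ hk (fun j hj => nn_dvd_sq hj), ← ha, dist_eq_norm]
    have hT := tail_succ ht k
    have hS : S (k + 1) t = S k t + (e a - e b) := by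
      unfold S; rw [Finset.sum_range_succ]; rfl
    rw [hS] at hT
    have het : e t = e b * e u := by rw [← e_add]; congr 1; linarith
    have key : X t + e t - (S k t + e (a + v)) =
        (X t - (S k t + (e a - e b))) + (e a - e b) * (1 - e u) + e a * (e u - e v) := by
      rw [het, e_add]; ring
    have h1 : ‖(e a - e b) * (1 - e u)‖ ≤ 1 / (nn k : ℝ) ^ 3 := by
      rw [norm_mul, norm_sub_rev 1]
      calc _ ≤ (1 / (nn k : ℝ)) * (1 / (nn k : ℝ) ^ 2) := by
            apply mul_le_mul ((e_lip _ _).trans hab) _ (norm_nonneg _) (by positivity)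
            refine (e_sub_one _).trans ?_
            rw [abs_of_nonneg hu0]; exact hu1.le
        _ = _ := by field_simp
    have h2 : ‖e a * (e u - e v)‖ ≤ 1 / (nn k : ℝ) ^ 3 := by
      rw [norm_mul, norm_e, one_mul]
      refine (e_lip _ _).trans ?_
      rw [abs_le]; constructor <;> linarith
    rw [key]
    refine (norm_add₃_le).trans ?_
    calc _ ≤ 2 / (nn k : ℝ) ^ 3 + 1 / (nn k : ℝ) ^ 3 + 1 / (nn k : ℝ) ^ 3 := by gcongr
      _ = _ := by ring

/-- The set before closure. -/
noncomputable def Q : Set ℂ := X '' Icc 0 10 ∪ (fun t => X t + e t) '' Icc 0 10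

lemma cov (k : ℕ) : closure Q ⊆ ⋃ x ∈ C1 k ∪ C2 k, closedBall x (4 / (nn k : ℝ) ^ 3) := by
  apply closure_minimal
  · rintro z (⟨t, ht, rfl⟩ | ⟨t, ht, rfl⟩)
    · obtain ⟨c, hc, h⟩ := cov1 k ht.1 ht.2
      exact mem_iUnion₂.2 ⟨c, Finset.mem_union_left _ hc, h⟩
    · obtain ⟨c, hc, h⟩ := cov2 k ht.1 ht.2
      exact mem_iUnion₂.2 ⟨c, Finset.mem_union_right _ hc, h⟩
  · exact (C1 k ∪ C2 k).finite_toSet.isClosed_biUnion fun _ _ => isClosed_closedBall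

lemma Q_compact : IsCompact (closure Q) := by
  apply Metric.isCompact_of_isClosed_isBounded isClosed_closure
  refine Bornology.IsBounded.subset ?_ (cov 0)
  exact (Bornology.isBounded_biUnion (C1 0 ∪ C2 0).finite_toSet).2
    fun _ _ => isBounded_closedBall

lemma sphere_Q {z : ℂ} (hz : ‖z‖ = 1) : ∃ p ∈ closure Q, ∃ q ∈ closure Q, p - q = z := by
  have h1 := Complex.neg_pi_lt_arg z
  have h2 := Complex.arg_le_pi z
  have h3 := Real.pi_lt_d2
  have ht : Complex.arg z + 2 * π ∈ Icc (0 : ℝ) 10 := by constructor <;> linarith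
  refine ⟨_, subset_closure (Or.inr ⟨_, ht, rfl⟩), _, subset_closure (Or.inl ⟨_, ht, rfl⟩), ?_⟩
  have h4 := Complex.norm_mul_exp_arg_mul_I z
  rw [hz] at h4
  simp only [add_sub_cancel_left, e]
  push_cast
  rw [mul_add, Complex.exp_add, show Complex.I * (2 * (π : ℂ)) = 2 * π * Complex.I by ring,
    Complex.exp_two_pi_mul_I, mul_one, mul_comm]
  simpa using h4

/-- The isometry of the complex plane with Euclidean space. -/
noncomputable def φ : ℂ ≃ₗᵢ[ℝ] EuclideanSpace ℝ (Fin 2) := Complex.orthonormalBasisOneI.repr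

lemma coverN_le (k : ℕ) :
    coverN (5 / (nn k : ℝ) ^ 3) (φ '' closure Q) ≤ ((22 * nn k ^ 2 : ℕ) : ℕ∞) := by
  classical
  have hk := nn_pos k
  have hsub : φ '' closure Q ⊆ ⋃ x ∈ (C1 k ∪ C2 k).image φ, ball x (5 / (nn k : ℝ) ^ 3) := by
    rintro _ ⟨z, hz, rfl⟩
    obtain ⟨c, hc, h⟩ := mem_iUnion₂.1 (cov k hz)
    refine mem_iUnion₂.2 ⟨φ c, Finset.mem_image_of_mem _ hc, ?_⟩
    rw [mem_ball, φ.dist_map]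
    refine lt_of_le_of_lt h ?_
    gcongr; norm_num
  have h1 : coverN (5 / (nn k : ℝ) ^ 3) (φ '' closure Q) ≤
      (((C1 k ∪ C2 k).image φ).card : ℕ∞) := by
    unfold coverN
    exact iInf_le_of_le ((C1 k ∪ C2 k).image φ) (iInf_le_of_le hsub le_rfl)
  refine h1.trans ?_
  exact_mod_cast Finset.card_image_le.trans (card_le k)

lemma log_nn (k : ℕ) : Real.log (nn k) = 4 ^ k * Real.log 2 := by
  unfold nn; push_cast; rw [Real.log_pow]; push_cast; rfl

lemma log_tendsto : Tendsto (fun k => Real.log (nn k)) atTop atTop := by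
  simp only [log_nn]
  exact (tendsto_pow_atTop_atTop_of_one_lt (by norm_num : (1 : ℝ) < 4)).atTop_mul_const
    (Real.log_pos (by norm_num))

lemma nn_tendsto : Tendsto (fun k => (nn k : ℝ)) atTop atTop := by
  refine tendsto_atTop_mono (fun k => ?_) log_tendsto
  exact Real.log_le_self (by positivity)

lemma scale_tendsto : Tendsto (fun k => 5 / (nn k : ℝ) ^ 3) atTop (𝓝[>] 0) := by
  refine tendsto_nhdsWithin_iff.2 ⟨?_, Eventually.of_forall fun k => ?_⟩
  · exact ((tendsto_pow_atTop (by norm_num)).comp nn_tendsto).const_div_atTop 5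
  · have := nn_pos k
    exact mem_Ioi.2 (by positivity)

lemma dim_le : lowerBoxDim (φ '' closure Q) ≤ 2 / 3 := by
  unfold lowerBoxDim
  rw [Filter.liminf_eq]
  apply Real.sSup_le _ (by norm_num)
  intro a ha
  by_contra! hlt
  have hev := scale_tendsto.eventually ha
  have hlarge := log_tendsto.eventually_gt_atTop
    (max (Real.log 5) ((Real.log 22 + a * Real.log 5) / (3 * a - 2)))
  obtain ⟨k, h1, h2⟩ := (hev.and hlarge).exists
  obtain ⟨h2, h3⟩ := max_lt_iff.1 h2
  have hk := nn_pos k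
  have hl5 : 0 < Real.log 5 := Real.log_pos (by norm_num)
  have e1 : Real.log (1 / (5 / (nn k : ℝ) ^ 3)) = 3 * Real.log (nn k) - Real.log 5 := by
    rw [one_div_div, Real.log_div (by positivity) (by norm_num), Real.log_pow]; norm_num
  rw [e1, le_div_iff₀ (by linarith)] at h1
  have hN : (coverN (5 / (nn k : ℝ) ^ 3) (φ '' closure Q)).toNat ≤ 22 * nn k ^ 2 :=
    ENat.toNat_le_of_le_natCast (coverN_le k)
  have e2 : Real.log ((coverN (5 / (nn k : ℝ) ^ 3) (φ '' closure Q)).toNat) ≤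
      Real.log 22 + 2 * Real.log (nn k) := by
    have : Real.log 22 + 2 * Real.log (nn k) = Real.log ((22 * nn k ^ 2 : ℕ) : ℝ) := by
      push_cast
      rw [Real.log_mul (by norm_num) (by positivity), Real.log_pow]; norm_num
    rw [this]
    rcases Nat.eq_zero_or_pos (coverN (5 / (nn k : ℝ) ^ 3) (φ '' closure Q)).toNat with h0 | h0
    · rw [h0, Nat.cast_zero, Real.log_zero]
      exact Real.log_natCast_nonneg _
    · exact Real.log_le_log (by exact_mod_cast h0) (by exact_mod_cast hN)
  rw [div_lt_iff₀ (by linarith)] at h3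
  nlinarith

end Dipole

theorem exists_compact_dipole_lowerBoxDim_le :
    ∃ P : Set (EuclideanSpace ℝ (Fin 2)), IsCompact P ∧
      Metric.sphere (0 : EuclideanSpace ℝ (Fin 2)) 1 ⊆ P - P ∧
      lowerBoxDim P ≤ 2 / 3 := by
  refine ⟨Dipole.φ '' closure Dipole.Q, Dipole.Q_compact.image Dipole.φ.continuous, ?_,
    Dipole.dim_le⟩
  intro w hw
  rw [mem_sphere_zero_iff_norm] at hw
  obtain ⟨p, hp, q, hq, h⟩ := Dipole.sphere_Q (z := Dipole.φ.symm w)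
    (by rw [LinearIsometryEquiv.norm_map]; exact hw)
  refine Set.mem_sub.2 ⟨_, ⟨p, hp, rfl⟩, _, ⟨q, hq, rfl⟩, ?_⟩
  rw [← map_sub, h, LinearIsometryEquiv.apply_symm_apply]
end

section
/- If A ⊆ ℝ² is a bounded set with A - A ⊇ S¹, then the lower box dimension of A is at least 4/7. -/
open Metric Filter Set Real
open scoped Topology Pointwise ENNReal

open Classical in
theorem card_cover_le {α β : Type*} (Q : Finset α) (W : Finset β) (R : β → α → Prop) (B : ℝ)
    (h1 : ∀ q ∈ Q, ∃ w ∈ W, R w q) (h2 : ∀ w ∈ W, ∀ G ⊆ Q, (∀ g ∈ G, R w g) → (G.card : ℝ) ≤ B) :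
    (Q.card : ℝ) ≤ W.card * B := by
  have hsub : Q ⊆ W.biUnion (fun w => Q.filter (R w)) := by
    intro q hq
    obtain ⟨w, hw, hr⟩ := h1 q hq
    exact Finset.mem_biUnion.2 ⟨w, hw, Finset.mem_filter.2 ⟨hq, hr⟩⟩
  have h3 : Q.card ≤ ∑ w ∈ W, (Q.filter (R w)).card :=
    (Finset.card_le_card hsub).trans Finset.card_biUnion_le
  calc (Q.card : ℝ) ≤ ((∑ w ∈ W, (Q.filter (R w)).card : ℕ) : ℝ) := by exact_mod_cast h3
    _ = ∑ w ∈ W, ((Q.filter (R w)).card : ℝ) := by push_cast; rfl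
    _ ≤ ∑ w ∈ W, B := Finset.sum_le_sum (fun w hw => h2 w hw _ (Finset.filter_subset _ _)
          (fun g hg => (Finset.mem_filter.1 hg).2))
    _ = W.card * B := by simp

theorem card_nat_le (F : Finset ℕ) (D : ℝ) (hD : 0 ≤ D)
    (h : ∀ i ∈ F, ∀ j ∈ F, |(i : ℝ) - j| ≤ D) : (F.card : ℝ) ≤ D + 1 := by
  rcases F.eq_empty_or_nonempty with rfl | hne
  · simp; linarith
  · set a := F.min' hne with ha
    have hsub : F ⊆ Finset.Icc a (a + ⌊D⌋₊) := by
      intro i hi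
      have hai : a ≤ i := F.min'_le i hi
      have h1 := h i hi a (F.min'_mem hne)
      rw [Finset.mem_Icc]
      refine ⟨hai, ?_⟩
      have h2 : ((i - a : ℕ) : ℝ) ≤ D := by
        rw [Nat.cast_sub hai]; exact (le_abs_self _).trans h1
      have := Nat.le_floor h2
      omega
    have h3 := Finset.card_le_card hsub
    rw [Nat.card_Icc] at h3
    have h4 : (F.card : ℝ) ≤ (⌊D⌋₊ : ℝ) + 1 := by
      have : F.card ≤ ⌊D⌋₊ + 1 := by omega
      exact_mod_cast this
    have := Nat.floor_le hD
    linarith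

open Classical in
theorem exists_centers {V : Type*} (S : Finset V) (D : V → V → ℝ) (ρ T : ℝ)
    (hρ : 0 ≤ ρ) (h0 : ∀ u, D u u = 0) (hs : ∀ u v, D u v = D v u)
    (ht : ∀ u v w, D u w ≤ D u v + D v w)
    (H : Finset V)
    (hH : ∀ u ∈ H, T ≤ ((S.filter (fun v => D u v ≤ ρ)).card : ℝ)) :
    ∃ C : Finset V, (C.card : ℝ) * T ≤ S.card ∧ ∀ u ∈ H, ∃ c ∈ C, D c u ≤ 2 * ρ := by
  obtain ⟨P, hP⟩ : ∃ P : Finset V → Prop, ∀ C, P C ↔ ∀ a ∈ C, ∀ b ∈ C, a ≠ b → 2 * ρ < D a b :=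
    ⟨_, fun _ => Iff.rfl⟩
  let Fam := H.powerset.filter P
  have hne : Fam.Nonempty := ⟨∅, by simp [Fam, hP]⟩
  obtain ⟨C, hC, hmax⟩ := Finset.exists_max_image Fam Finset.card hne
  have hC' := Finset.mem_filter.1 hC
  have hCH : C ⊆ H := Finset.mem_powerset.1 hC'.1
  have hsep := (hP C).1 hC'.2
  refine ⟨C, ?_, ?_⟩
  · have hdisj : (C : Set V).PairwiseDisjoint (fun c => S.filter (fun v => D c v ≤ ρ)) := by
      intro a ha b hb hab
      rw [Function.onFun, Finset.disjoint_left]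
      intro v hv hv'
      have h1 := (Finset.mem_filter.1 hv).2
      have h2 := (Finset.mem_filter.1 hv').2
      have h3 := hsep a ha b hb hab
      have h4 := ht a v b
      rw [hs v b] at h4
      linarith
    have h1 : (C.biUnion (fun c => S.filter (fun v => D c v ≤ ρ))).card ≤ S.card := by
      apply Finset.card_le_card
      intro v hv
      obtain ⟨c, _, hv⟩ := Finset.mem_biUnion.1 hv
      exact (Finset.mem_filter.1 hv).1
    rw [Finset.card_biUnion hdisj] at h1
    calc (C.card : ℝ) * T = ∑ c ∈ C, T := by simp
      _ ≤ ∑ c ∈ C, ((S.filter (fun v => D c v ≤ ρ)).card : ℝ) :=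
          Finset.sum_le_sum (fun c hc => hH c (hCH hc))
      _ ≤ S.card := by exact_mod_cast h1
  · intro u hu
    by_contra hcon
    push Not at hcon
    have huC : u ∉ C := by
      intro huC
      have := hcon u huC
      rw [h0] at this
      linarith
    have hmem : insert u C ∈ Fam := by
      refine Finset.mem_filter.2 ⟨Finset.mem_powerset.2 (Finset.insert_subset hu hCH), (hP _).2 ?_⟩
      intro a ha b hb hab
      rcases Finset.mem_insert.1 ha with ha | ha <;> rcases Finset.mem_insert.1 hb with hb | hb
      · exact absurd (ha.trans hb.symm) hab
      · rw [hs, ha]; exact hcon b hb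
      · rw [hb]; exact hcon a ha
      · exact hsep a ha b hb hab
    have := hmax _ hmem
    rw [Finset.card_insert_of_notMem huC] at this
    omega

open Classical in
theorem both_heavy_count {V : Type*} (S : Finset V) (D : V → V → ℝ)
    (h0 : ∀ u, D u u = 0) (hs : ∀ u v, D u v = D v u)
    (ht : ∀ u v w, D u w ≤ D u v + D v w) (x y : ℕ → V) (J : ℕ)
    (H1 : ∀ i < J, ∀ j < J, |(i : ℝ) - j| ≤ D (x i) (x j) + D (y i) (y j) + 1)
    (ρ T ρ' T' : ℝ) (hρ : 0 ≤ ρ) (hρ' : 0 ≤ ρ') (hT : 0 < T) (hT' : 0 < T')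
    (F : Finset ℕ) (hF : ∀ i ∈ F, i < J)
    (hx : ∀ i ∈ F, T ≤ ((S.filter (fun v => D (x i) v ≤ ρ)).card : ℝ))
    (hy : ∀ i ∈ F, T' ≤ ((S.filter (fun v => D (y i) v ≤ ρ')).card : ℝ)) :
    (F.card : ℝ) ≤ (S.card / T) * (S.card / T') * (4 * ρ + 4 * ρ' + 2) := by
  obtain ⟨C, hC, hC2⟩ := exists_centers S D ρ T hρ h0 hs ht (F.image x) (by
    intro u hu
    obtain ⟨i, hi, rfl⟩ := Finset.mem_image.1 hu
    exact hx i hi)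
  obtain ⟨C', hC', hC2'⟩ := exists_centers S D ρ' T' hρ' h0 hs ht (F.image y) (by
    intro u hu
    obtain ⟨i, hi, rfl⟩ := Finset.mem_image.1 hu
    exact hy i hi)
  have key := card_cover_le F (C ×ˢ C')
    (fun w i => D w.1 (x i) ≤ 2 * ρ ∧ D w.2 (y i) ≤ 2 * ρ') (4 * ρ + 4 * ρ' + 2)
    (by
      intro i hi
      obtain ⟨c, hc, h1⟩ := hC2 (x i) (Finset.mem_image_of_mem x hi)
      obtain ⟨c', hc', h2⟩ := hC2' (y i) (Finset.mem_image_of_mem y hi)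
      exact ⟨(c, c'), Finset.mem_product.2 ⟨hc, hc'⟩, h1, h2⟩)
    (by
      rintro ⟨c, c'⟩ - G hGF hG
      have := card_nat_le G
        (4 * ρ + 4 * ρ' + 1) (by linarith) (by
          intro i hi j hj
          obtain ⟨hi1, hi2⟩ := hG i hi
          obtain ⟨hj1, hj2⟩ := hG j hj
          replace hi := hGF hi
          replace hj := hGF hj
          simp only at hi1 hi2 hj1 hj2
          have a1 := H1 i (hF i hi) j (hF j hj)
          have a2 := ht (x i) c (x j)
          have a3 := ht (y i) c' (y j)
          rw [hs (x i) c] at a2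
          rw [hs (y i) c'] at a3
          linarith)
      linarith)
  rw [Finset.card_product] at key
  push_cast at key
  have b1 : (C.card : ℝ) ≤ S.card / T := by rw [le_div_iff₀ hT]; exact hC
  have b2 : (C'.card : ℝ) ≤ S.card / T' := by rw [le_div_iff₀ hT']; exact hC'
  refine key.trans ?_
  gcongr

open Classical in
theorem card_pairs_ge {V : Type*} (S : Finset V) (y : ℕ → V) (I : Finset ℕ)
    (hy : ∀ i ∈ I, y i ∈ S) :
    (I.card : ℝ) ^ 2 ≤ S.card * (((I ×ˢ I).filter (fun p => y p.1 = y p.2)).card : ℝ) := by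
  have h1 : I.card = ∑ v ∈ S, (I.filter (fun i => y i = v)).card :=
    Finset.card_eq_sum_card_fiberwise hy
  have h2 : ((I ×ˢ I).filter (fun p => y p.1 = y p.2)).card
      = ∑ v ∈ S, (I.filter (fun i => y i = v)).card ^ 2 := by
    rw [Finset.card_eq_sum_card_fiberwise (f := fun p : ℕ × ℕ => y p.1) (t := S)]
    · refine Finset.sum_congr rfl fun v _ => ?_
      rw [sq, ← Finset.card_product]
      congr 1
      ext ⟨i, j⟩
      simp only [Finset.mem_filter, Finset.mem_product]
      constructor
      · rintro ⟨⟨⟨a, b⟩, c⟩, d⟩; exact ⟨⟨a, d⟩, b, c ▸ d⟩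
      · rintro ⟨⟨a, b⟩, c, d⟩; exact ⟨⟨⟨a, c⟩, b.trans d.symm⟩, b⟩
    · intro p hp
      have hp' := (Finset.mem_filter.1 hp).1
      exact hy _ (Finset.mem_product.1 hp').1
  have h3 := sq_sum_le_card_mul_sum_sq (s := S)
    (f := fun v => ((I.filter (fun i => y i = v)).card : ℝ))
  rw [h2]
  have h4 : (I.card : ℝ) = ∑ v ∈ S, ((I.filter (fun i => y i = v)).card : ℝ) := by
    exact_mod_cast h1
  rw [h4]
  push_cast
  exact h3

open Classical in
theorem light_count {V : Type*} (S : Finset V) (D : V → V → ℝ) (x y : ℕ → V) (J K : ℕ)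
    (M μ : ℝ) (T : ℕ → ℝ) (hμ : 1 ≤ μ) (hMJ : (J : ℝ) ≤ M) (hK : (J : ℝ) ≤ μ * 2 ^ (K + 1))
    (hxS : ∀ i < J, x i ∈ S) (hyS : ∀ i < J, y i ∈ S)
    (H2 : ∀ i < J, ∀ j < J, y i = y j → D (x i) (x j) ≤ 3 * |(i : ℝ) - j|)
    (H3 : ∀ i < J, ∀ j < J, ∀ i' < J, ∀ j' < J, x i = x i' → x j = x j' → y i = y j →
      y i' = y j' → (i : ℤ) - j = i' - j' ∧ |(i : ℝ) - i'| * |(i : ℝ) - j| ≤ M)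
    (I : Finset ℕ) (hI : ∀ i ∈ I, i < J)
    (hT : ∀ k, 0 ≤ T k)
    (hl : ∀ i ∈ I, ∀ k ≤ K,
      ((S.filter (fun v => D (x i) v ≤ 6 * μ * 2 ^ k)).card : ℝ) ≤ T k) :
    (I.card : ℝ) ^ 2 ≤ S.card * (J * (3 * μ) +
      ∑ k ∈ Finset.range (K + 1), S.card * T k * (2 * M / (μ * 2 ^ k))) := by
  refine (card_pairs_ge S y I (fun i hi => hyS i (hI i hi))).trans ?_
  refine mul_le_mul_of_nonneg_left ?_ (Nat.cast_nonneg _)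
  set Q := (I ×ˢ I).filter (fun p => y p.1 = y p.2) with hQ
  let N0 := Q.filter (fun p => |(p.1 : ℝ) - p.2| ≤ μ)
  let Qk := fun k : ℕ => Q.filter (fun p => μ * 2 ^ k < |(p.1 : ℝ) - p.2| ∧
    |(p.1 : ℝ) - p.2| ≤ μ * 2 ^ (k + 1))
  have hQm : ∀ p ∈ Q, p.1 ∈ I ∧ p.2 ∈ I ∧ y p.1 = y p.2 := by
    intro p hp
    have h1 := Finset.mem_filter.1 hp
    have h2 := Finset.mem_product.1 h1.1
    exact ⟨h2.1, h2.2, h1.2⟩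
  have hcov : Q ⊆ N0 ∪ (Finset.range (K + 1)).biUnion Qk := by
    intro p hp
    obtain ⟨p1, p2, -⟩ := hQm p hp
    by_cases hn : |(p.1 : ℝ) - p.2| ≤ μ
    · exact Finset.mem_union_left _ (Finset.mem_filter.2 ⟨hp, hn⟩)
    · apply Finset.mem_union_right
      push Not at hn
      have hex : ∃ k, |(p.1 : ℝ) - p.2| ≤ μ * 2 ^ (k + 1) := by
        refine ⟨K, le_trans ?_ hK⟩
        have a1 : (p.1 : ℝ) < J := by exact_mod_cast hI _ p1
        have a2 : (p.2 : ℝ) < J := by exact_mod_cast hI _ p2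
        have a3 : (0 : ℝ) ≤ p.1 := Nat.cast_nonneg _
        have a4 : (0 : ℝ) ≤ p.2 := Nat.cast_nonneg _
        rw [abs_le]; constructor <;> linarith
      have hKex : |(p.1 : ℝ) - p.2| ≤ μ * 2 ^ (K + 1) := by
        refine le_trans ?_ hK
        have a1 : (p.1 : ℝ) < J := by exact_mod_cast hI _ p1
        have a2 : (p.2 : ℝ) < J := by exact_mod_cast hI _ p2
        have a3 : (0 : ℝ) ≤ p.1 := Nat.cast_nonneg _
        have a4 : (0 : ℝ) ≤ p.2 := Nat.cast_nonneg _
        rw [abs_le]; constructor <;> linarith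
      refine Finset.mem_biUnion.2 ⟨Nat.find hex, ?_, Finset.mem_filter.2 ⟨hp, ?_, Nat.find_spec hex⟩⟩
      · rw [Finset.mem_range]
        have := Nat.find_min' hex hKex
        omega
      · rcases Nat.eq_zero_or_pos (Nat.find hex) with h0 | h0
        · rw [h0]; simpa using hn
        · have := Nat.find_min hex (m := Nat.find hex - 1) (by omega)
          push Not at this
          rwa [Nat.sub_add_cancel h0] at this
  have hN0 : (N0.card : ℝ) ≤ J * (3 * μ) := by
    have h1 := card_cover_le N0 I (fun i p => p.1 = i) (3 * μ)
      (by
        intro p hp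
        exact ⟨p.1, (hQm p (Finset.mem_filter.1 hp).1).1, rfl⟩)
      (by
        intro i hi G hGN hG
        have hinj : Set.InjOn (fun p : ℕ × ℕ => p.2) (G : Set (ℕ × ℕ)) := by
          rintro ⟨a, b⟩ h ⟨a', b'⟩ h' hb
          have e1 : a = i := hG _ h
          have e2 : a' = i := hG _ h'
          simp only at hb
          rw [e1, e2, hb]
        rw [← Finset.card_image_of_injOn hinj]
        have := card_nat_le (G.image (fun p : ℕ × ℕ => p.2)) (2 * μ)
          (by linarith) (by
            intro j hj j' hj'
            obtain ⟨⟨a, b⟩, h, rfl⟩ := Finset.mem_image.1 hj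
            obtain ⟨⟨a', b'⟩, h', rfl⟩ := Finset.mem_image.1 hj'
            have e1 : a = i := hG _ h
            have e2 : a' = i := hG _ h'
            have f1 := (Finset.mem_filter.1 (hGN h)).2
            have f2 := (Finset.mem_filter.1 (hGN h')).2
            simp only at f1 f2 ⊢
            rw [e1] at f1
            rw [e2] at f2
            rw [abs_le] at *
            constructor <;> linarith [f1.1, f1.2, f2.1, f2.2])
        linarith)
    have h2 : (I.card : ℝ) ≤ J := by
      have : I ⊆ Finset.range J := fun i hi => Finset.mem_range.2 (hI i hi)
      have := Finset.card_le_card this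
      rw [Finset.card_range] at this
      exact_mod_cast this
    refine h1.trans ?_
    gcongr
  have hQk : ∀ k ∈ Finset.range (K + 1),
      ((Qk k).card : ℝ) ≤ S.card * T k * (2 * M / (μ * 2 ^ k)) := by
    intro k hk
    have hkK : k ≤ K := by have := Finset.mem_range.1 hk; omega
    have hpos : 0 < μ * 2 ^ k := by positivity
    have hM0 : 0 ≤ M := le_trans (Nat.cast_nonneg _) hMJ
    let W := (S ×ˢ S).filter (fun w => (∃ i ∈ I, x i = w.1) ∧ D w.1 w.2 ≤ 6 * μ * 2 ^ k)
    have hW : (W.card : ℝ) ≤ S.card * T k := by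
      refine card_cover_le W S (fun u w => w.1 = u) (T k) ?_ ?_
      · intro w hw
        exact ⟨w.1, (Finset.mem_product.1 (Finset.mem_filter.1 hw).1).1, rfl⟩
      · intro u hu G hGW hG
        by_cases hui : ∃ i ∈ I, x i = u
        · obtain ⟨i, hi, rfl⟩ := hui
          refine le_trans ?_ (hl i hi k hkK)
          have hinj : Set.InjOn (fun p : V × V => p.2) (G : Set (V × V)) := by
            rintro ⟨a, b⟩ h ⟨a', b'⟩ h' hb
            have e1 : a = x i := hG _ h
            have e2 : a' = x i := hG _ h'
            simp only at hb
            rw [e1, e2, hb]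
          rw [← Finset.card_image_of_injOn hinj]
          have : G.image (fun p : V × V => p.2) ⊆
              S.filter (fun v => D (x i) v ≤ 6 * μ * 2 ^ k) := by
            intro v hv
            obtain ⟨⟨a, b⟩, h, rfl⟩ := Finset.mem_image.1 hv
            have e1 : a = x i := hG _ h
            have e2 := Finset.mem_filter.1 (hGW h)
            subst e1
            exact Finset.mem_filter.2 ⟨(Finset.mem_product.1 e2.1).2, e2.2.2⟩
          exact_mod_cast Finset.card_le_card this
        · have : G = ∅ := by
            rw [Finset.eq_empty_iff_forall_notMem]
            intro w hw
            have h1 := (Finset.mem_filter.1 (hGW hw)).2.1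
            rw [hG w hw] at h1
            exact hui h1
          rw [this]
          simpa using hT k
    have h1 := card_cover_le (Qk k) W (fun w p => x p.1 = w.1 ∧ x p.2 = w.2) (2 * M / (μ * 2 ^ k))
      (by
        intro p hp
        obtain ⟨hp1, hp2, hp3⟩ := Finset.mem_filter.1 hp
        obtain ⟨q1, q2, q3⟩ := hQm p hp1
        refine ⟨(x p.1, x p.2), Finset.mem_filter.2 ⟨Finset.mem_product.2
          ⟨hxS _ (hI _ q1), hxS _ (hI _ q2)⟩, ⟨p.1, q1, rfl⟩, ?_⟩, rfl, rfl⟩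
        have := H2 _ (hI _ q1) _ (hI _ q2) q3
        refine this.trans ?_
        rw [pow_succ] at hp3
        linarith)
      (by
        rintro ⟨u, v⟩ - G hGQ hG
        have hGm : ∀ p ∈ G, p.1 < J ∧ p.2 < J ∧ y p.1 = y p.2 ∧ x p.1 = u ∧ x p.2 = v ∧
            μ * 2 ^ k < |(p.1 : ℝ) - p.2| := by
          intro p hp
          obtain ⟨g2, g3⟩ := hG p hp
          have g1 := hGQ hp
          obtain ⟨hp1, hp2, hp3⟩ := Finset.mem_filter.1 g1
          obtain ⟨q1, q2, q3⟩ := hQm p hp1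
          exact ⟨hI _ q1, hI _ q2, q3, g2, g3, hp2⟩
        rcases G.eq_empty_or_nonempty with he | ⟨p0, hp0⟩
        · rw [he]; simp; positivity
        · have hbig : μ * 2 ^ k ≤ M := by
            obtain ⟨a1, a2, -, -, -, a6⟩ := hGm p0 hp0
            refine a6.le.trans (le_trans ?_ hMJ)
            have a1 : (p0.1 : ℝ) < J := by exact_mod_cast a1
            have a2 : (p0.2 : ℝ) < J := by exact_mod_cast a2
            have a3 : (0 : ℝ) ≤ p0.1 := Nat.cast_nonneg _
            have a4 : (0 : ℝ) ≤ p0.2 := Nat.cast_nonneg _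
            rw [abs_le]; constructor <;> linarith
          have hinj : Set.InjOn (fun p : ℕ × ℕ => p.1) (G : Set (ℕ × ℕ)) := by
            rintro ⟨a, b⟩ h ⟨a', b'⟩ h' hb
            simp only at hb
            subst hb
            obtain ⟨a1, a2, a3, a4, a5, a6⟩ := hGm _ h
            obtain ⟨b1, b2, b3, b4, b5, b6⟩ := hGm _ h'
            have := (H3 _ a1 _ a2 _ b1 _ b2 rfl (a5.trans b5.symm) a3 b3).1
            simp only at this
            have : b = b' := by omega
            rw [this]
          rw [← Finset.card_image_of_injOn hinj]
          have h5 := card_nat_le (G.image (fun p : ℕ × ℕ => p.1)) (M / (μ * 2 ^ k))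
            (by positivity) (by
              intro i hi i' hi'
              obtain ⟨p, h, rfl⟩ := Finset.mem_image.1 hi
              obtain ⟨p', h', rfl⟩ := Finset.mem_image.1 hi'
              obtain ⟨a1, a2, a3, a4, a5, a6⟩ := hGm _ h
              obtain ⟨b1, b2, b3, b4, b5, b6⟩ := hGm _ h'
              have := (H3 _ a1 _ a2 _ b1 _ b2 (a4.trans b4.symm) (a5.trans b5.symm) a3 b3).2
              rw [le_div_iff₀ hpos]
              refine le_trans ?_ this
              gcongr)
          have h6 : 1 ≤ M / (μ * 2 ^ k) := by rwa [le_div_iff₀ hpos, one_mul]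
          have h7 : 2 * M / (μ * 2 ^ k) = M / (μ * 2 ^ k) + M / (μ * 2 ^ k) := by ring
          linarith)
    refine h1.trans ?_
    gcongr
  have hc1 : Q.card ≤ N0.card + ∑ k ∈ Finset.range (K + 1), (Qk k).card :=
    (Finset.card_le_card hcov).trans ((Finset.card_union_le _ _).trans
      (Nat.add_le_add_left Finset.card_biUnion_le _))
  calc (Q.card : ℝ) ≤ N0.card + ∑ k ∈ Finset.range (K + 1), ((Qk k).card : ℝ) := by
        exact_mod_cast hc1
    _ ≤ _ := add_le_add hN0 (Finset.sum_le_sum hQk)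

theorem dipole_fin (n κ q μ M J : ℝ) (K : ℕ) (hn1 : 1 ≤ n) (hκ1 : 1 ≤ κ) (hq1 : 1 ≤ q) (hμ0 : 0 < μ)
    (hJ1 : 1 ≤ J) (hMJ' : M ≤ 5 * J) (hKκ : ((K + 1 : ℕ) : ℝ) = κ) (hμn : μ * (128 * n) = J)
    (c : ℝ) (hc : J / 4 ≤ c) (h : c ^ 2 ≤ n * (J * (3 * μ) +
      ∑ k ∈ Finset.range (K + 1), n * (κ * 2 ^ k * q) * (2 * M / (μ * 2 ^ k)))) :
      J ^ 2 ≤ 32768 * κ ^ 2 * (n ^ 3 * q) := by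
  have e1 : ∀ k ∈ Finset.range (K + 1), n * (κ * 2 ^ k * q) * (2 * M / (μ * 2 ^ k)) = n * κ * q * (2 * M / μ) := by
    intro k _
    field_simp
  rw [Finset.sum_congr rfl e1, Finset.sum_const, Finset.card_range, nsmul_eq_mul, hKκ] at h
  have e2 : 2 * M / μ ≤ 1280 * n := by
    rw [div_le_iff₀ hμ0]
    nlinarith
  have e3 : κ * (n * κ * q * (2 * M / μ)) ≤ κ * (n * κ * q * (1280 * n)) := by gcongr
  have e4 : c ^ 2 ≤ n * (J * (3 * μ) + κ * (n * κ * q * (1280 * n))) :=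
    h.trans (by gcongr)
  have e5 : ((J : ℝ) / 4) ^ 2 ≤ c ^ 2 := by gcongr
  have e6 : n * (J * (3 * μ)) = 3 / 128 * J ^ 2 := by
    have : n * μ = J / 128 := by linarith
    calc n * (J * (3 * μ)) = 3 * J * (n * μ) := by ring
      _ = _ := by rw [this]; ring
  have e7 : 0 ≤ κ ^ 2 * (n ^ 3 * q) := by positivity
  nlinarith

set_option maxHeartbeats 1000000 in
open Classical in
theorem dipole_comb {V : Type*} (S : Finset V) (D : V → V → ℝ)
    (h0 : ∀ u, D u u = 0) (hs : ∀ u v, D u v = D v u)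
    (ht : ∀ u v w, D u w ≤ D u v + D v w) (x y : ℕ → V) (J : ℕ) (M : ℝ)
    (hN : 1 ≤ S.card) (hJ : 1 ≤ J)
    (hMJ : (J : ℝ) ≤ M) (hMJ' : M ≤ 5 * J)
    (hxS : ∀ i < J, x i ∈ S) (hyS : ∀ i < J, y i ∈ S)
    (H1 : ∀ i < J, ∀ j < J, |(i : ℝ) - j| ≤ D (x i) (x j) + D (y i) (y j) + 1)
    (H2x : ∀ i < J, ∀ j < J, y i = y j → D (x i) (x j) ≤ 3 * |(i : ℝ) - j|)
    (H2y : ∀ i < J, ∀ j < J, x i = x j → D (y i) (y j) ≤ 3 * |(i : ℝ) - j|)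
    (H3x : ∀ i < J, ∀ j < J, ∀ i' < J, ∀ j' < J, x i = x i' → x j = x j' → y i = y j →
      y i' = y j' → (i : ℤ) - j = i' - j' ∧ |(i : ℝ) - i'| * |(i : ℝ) - j| ≤ M)
    (H3y : ∀ i < J, ∀ j < J, ∀ i' < J, ∀ j' < J, y i = y i' → y j = y j' → x i = x j →
      x i' = x j' → (i : ℤ) - j = i' - j' ∧ |(i : ℝ) - i'| * |(i : ℝ) - j| ≤ M) :
    (J : ℝ) ^ 2 ≤ 32768 * ((Nat.log 2 S.card : ℝ) + 8) ^ 2 * ((S.card : ℝ) ^ 3 * √(S.card : ℝ)) := by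
  set n : ℝ := (S.card : ℝ) with hn
  have hn1 : (1 : ℝ) ≤ n := by rw [hn]; exact_mod_cast hN
  have hJ1 : (1 : ℝ) ≤ J := by exact_mod_cast hJ
  set K := Nat.log 2 S.card + 7 with hK
  set κ : ℝ := (Nat.log 2 S.card : ℝ) + 8 with hκ
  have hκ1 : 1 ≤ κ := by
    have : (0 : ℝ) ≤ (Nat.log 2 S.card : ℝ) := Nat.cast_nonneg _
    linarith
  have hKκ : ((K + 1 : ℕ) : ℝ) = κ := by rw [hK, hκ]; push_cast; ring
  set q := √n with hq
  have hq1 : 1 ≤ q := by rw [hq]; exact Real.one_le_sqrt.2 hn1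
  have hqq : q * q = n := Real.mul_self_sqrt (by linarith)
  set μ : ℝ := J / (128 * n) with hμd
  have hμn : μ * (128 * n) = J := by rw [hμd]; field_simp
  rcases lt_or_ge μ 1 with hμ | hμ
  · have a1 : (J : ℝ) ≤ 128 * n := by nlinarith
    have a2 : (J : ℝ) ^ 2 ≤ (128 * n) ^ 2 := by gcongr
    have a3 : n ^ 2 * 1 ≤ n ^ 3 * q := by gcongr <;> norm_num
    have a4 : 1 ≤ κ ^ 2 := by nlinarith
    calc (J : ℝ) ^ 2 ≤ 32768 * 1 * (n ^ 2 * 1) := by nlinarith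
      _ ≤ 32768 * κ ^ 2 * (n ^ 3 * q) := by gcongr
  have hμ0 : 0 < μ := by linarith
  have hKJ : (J : ℝ) ≤ μ * 2 ^ (K + 1) := by
    rw [← hμn]
    gcongr
    have : S.card < 2 ^ (Nat.log 2 S.card + 1) := Nat.lt_pow_succ_log_self (by norm_num) _
    have h2 : 128 * S.card ≤ 2 ^ (K + 1) := by
      rw [hK]
      have : 2 ^ (Nat.log 2 S.card + 7 + 1) = 128 * 2 ^ (Nat.log 2 S.card + 1) := by ring
      omega
    rw [hn]
    exact_mod_cast h2
  let T : ℕ → ℝ := fun k => κ * 2 ^ k * q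
  have hTpos : ∀ k, 0 < T k := fun k => by positivity
  obtain ⟨Hv, hHv⟩ : ∃ Hv : V → ℕ → Prop, ∀ u k, Hv u k ↔
      T k ≤ ((S.filter (fun v => D u v ≤ 6 * μ * 2 ^ k)).card : ℝ) := ⟨_, fun _ _ => Iff.rfl⟩
  obtain ⟨hvy, hhvy⟩ : ∃ P : V → Prop, ∀ u, P u ↔ ∃ k ≤ K, Hv u k := ⟨_, fun _ => Iff.rfl⟩
  let B := (Finset.range J).filter (fun i => hvy (x i) ∧ hvy (y i))
  let Ix := (Finset.range J).filter (fun i => ¬ hvy (x i))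
  let Iy := (Finset.range J).filter (fun i => ¬ hvy (y i))
  have hB : (B.card : ℝ) ≤ J / 2 := by
    have h1 := card_cover_le B (Finset.range (K + 1) ×ˢ Finset.range (K + 1))
      (fun w i => Hv (x i) w.1 ∧ Hv (y i) w.2) (J / (2 * κ ^ 2))
      (by
        intro i hi
        obtain ⟨_, hx, hy⟩ := Finset.mem_filter.1 hi
        obtain ⟨k, hk, hx⟩ := (hhvy _).1 hx
        obtain ⟨l, hl, hy⟩ := (hhvy _).1 hy
        exact ⟨(k, l), Finset.mem_product.2 ⟨Finset.mem_range.2 (by omega),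
          Finset.mem_range.2 (by omega)⟩, hx, hy⟩)
      (by
        rintro ⟨k, l⟩ - G hGB hG
        have h2 := both_heavy_count S D h0 hs ht x y J H1 (6 * μ * 2 ^ k) (T k) (6 * μ * 2 ^ l) (T l)
          (by positivity) (by positivity) (hTpos k) (hTpos l) G
          (fun i hi => Finset.mem_range.1 (Finset.mem_filter.1 (hGB hi)).1)
          (fun i hi => (hHv _ _).1 (hG i hi).1) (fun i hi => (hHv _ _).1 (hG i hi).2)
        refine h2.trans ?_
        have hk1 : (1 : ℝ) ≤ 2 ^ k := one_le_pow₀ (by norm_num)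
        have hl1 : (1 : ℝ) ≤ 2 ^ l := one_le_pow₀ (by norm_num)
        generalize hak : (2 : ℝ) ^ k = a at *
        generalize hbl : (2 : ℝ) ^ l = b at *
        have e1 : n / T k * (n / T l) = n / (κ ^ 2 * (a * b)) := by
          simp only [T, hak, hbl]
          rw [div_mul_div_comm, div_eq_div_iff (by positivity) (by positivity)]
          rw [← hqq]; ring
        rw [e1]
        have e2 : 4 * (6 * μ * a) + 4 * (6 * μ * b) + 2 ≤ 60 * μ * (a * b) := by
          have c1 : a + b ≤ 1 + a * b := by nlinarith
          have c2 : 1 ≤ a * b := by nlinarith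
          nlinarith
        calc n / (κ ^ 2 * (a * b)) * (4 * (6 * μ * a) + 4 * (6 * μ * b) + 2)
            ≤ n / (κ ^ 2 * (a * b)) * (60 * μ * (a * b)) := by gcongr
          _ = 60 * (μ * n) / κ ^ 2 := by field_simp
          _ = (60 / 128) * J / κ ^ 2 := by rw [← hμn]; ring
          _ ≤ (1 / 2) * J / κ ^ 2 := by
              apply div_le_div_of_nonneg_right _ (by positivity)
              nlinarith
          _ = J / (2 * κ ^ 2) := by field_simp)
    rw [Finset.card_product, Finset.card_range] at h1
    push_cast at h1 hKκ
    rw [hKκ] at h1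
    refine h1.trans (le_of_eq ?_)
    field_simp
  have hsum : J ≤ B.card + Ix.card + Iy.card := by
    have : Finset.range J ⊆ B ∪ Ix ∪ Iy := by
      intro i hi
      simp only [Finset.mem_union, B, Ix, Iy, Finset.mem_filter, hi, true_and]
      tauto
    have h1 := Finset.card_le_card this
    rw [Finset.card_range] at h1
    have h2 := Finset.card_union_le (B ∪ Ix) Iy
    have h3 := Finset.card_union_le B Ix
    omega
  have hsum' : (J : ℝ) ≤ B.card + Ix.card + Iy.card := by exact_mod_cast hsum
  rcases le_total ((J : ℝ) / 4) Ix.card with hx | hx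
  · refine dipole_fin n κ q μ M J K hn1 hκ1 hq1 hμ0 hJ1 hMJ' hKκ hμn _ hx (light_count S D x y J K M μ T hμ hMJ hKJ hxS hyS H2x H3x Ix ?_ ?_ ?_)
    · intro i hi; exact Finset.mem_range.1 (Finset.mem_filter.1 hi).1
    · exact fun k => (hTpos k).le
    · intro i hi k hk
      by_contra hcon
      push Not at hcon
      exact (Finset.mem_filter.1 hi).2 ((hhvy _).2 ⟨k, hk, (hHv _ _).2 hcon.le⟩)
  · have hy : (J : ℝ) / 4 ≤ Iy.card := by linarith
    refine dipole_fin n κ q μ M J K hn1 hκ1 hq1 hμ0 hJ1 hMJ' hKκ hμn _ hy (light_count S D y x J K M μ T hμ hMJ hKJ hyS hxS H2y H3y Iy ?_ ?_ ?_)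
    · intro i hi; exact Finset.mem_range.1 (Finset.mem_filter.1 hi).1
    · exact fun k => (hTpos k).le
    · intro i hi k hk
      by_contra hcon
      push Not at hcon
      exact (Finset.mem_filter.1 hi).2 ((hhvy _).2 ⟨k, hk, (hHv _ _).2 hcon.le⟩)

theorem g_facts (t : ℝ) (h0 : 0 ≤ t) (h1 : t ≤ 1 / 4) :
    √(1 - t ^ 2) ^ 2 + t ^ 2 = 1 ∧ 24 / 25 ≤ √(1 - t ^ 2) ∧ √(1 - t ^ 2) ≤ 1 := by
  have h2 : 0 ≤ 1 - t ^ 2 := by nlinarith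
  refine ⟨by rw [Real.sq_sqrt h2]; ring, ?_, ?_⟩
  · apply Real.le_sqrt_of_sq_le; nlinarith
  · rw [Real.sqrt_le_one]; nlinarith [sq_nonneg t]

theorem g_lip (t s : ℝ) (h0 : 0 ≤ t) (h1 : t ≤ 1 / 4) (h0' : 0 ≤ s) (h1' : s ≤ 1 / 4) :
    |√(1 - t ^ 2) - √(1 - s ^ 2)| ≤ |t - s| / 3 := by
  obtain ⟨a1, a2, a3⟩ := g_facts t h0 h1
  obtain ⟨b1, b2, b3⟩ := g_facts s h0' h1'
  generalize √(1 - t ^ 2) = a at *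
  generalize √(1 - s ^ 2) = b at *
  have e : (a - b) * (a + b) = -((t - s) * (t + s)) := by nlinarith
  have e2 : |a - b| * (a + b) = |t - s| * (t + s) := by
    have := congrArg abs e
    rwa [abs_neg, abs_mul, abs_mul, abs_of_nonneg (by linarith : 0 ≤ a + b),
      abs_of_nonneg (by linarith : 0 ≤ t + s)] at this
  have e3 : |a - b| * (48 / 25) ≤ |a - b| * (a + b) :=
    mul_le_mul_of_nonneg_left (by linarith) (abs_nonneg _)
  have e4 : |t - s| * (t + s) ≤ |t - s| * (1 / 2) :=
    mul_le_mul_of_nonneg_left (by linarith) (abs_nonneg _)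
  linarith [abs_nonneg (t - s)]

theorem g_codeg (r t s t' s' : ℝ) (h0 : 0 ≤ t) (h1 : t ≤ 1 / 4) (h0' : 0 ≤ s) (h1' : s ≤ 1 / 4)
    (k0 : 0 ≤ t') (k1 : t' ≤ 1 / 4) (k0' : 0 ≤ s') (k1' : s' ≤ 1 / 4)
    (hw : t - s = t' - s')
    (hg : |√(1 - t ^ 2) - √(1 - s ^ 2) - (√(1 - t' ^ 2) - √(1 - s' ^ 2))| ≤ 8 * r) :
    |t - t'| * |t - s| ≤ 9 * r := by
  have l1 := g_lip t s h0 h1 h0' h1'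
  have l2 := g_lip t t' h0 h1 k0 k1
  have l3 := g_lip s s' h0' h1' k0' k1'
  obtain ⟨a1, a2, a3⟩ := g_facts t h0 h1
  obtain ⟨b1, b2, b3⟩ := g_facts s h0' h1'
  obtain ⟨c1, c2, c3⟩ := g_facts t' k0 k1
  obtain ⟨d1, d2, d3⟩ := g_facts s' k0' k1'
  generalize √(1 - t ^ 2) = a at *
  generalize √(1 - s ^ 2) = b at *
  generalize √(1 - t' ^ 2) = c at *
  generalize √(1 - s' ^ 2) = d at *
  have hs : s - s' = t - t' := by linarith
  rw [hs] at l3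
  have key : 2 * ((t - t') * (t - s)) = -((a - b) * ((a - c) + (b - d))) - (a - b - (c - d)) * (c + d) := by
    have es : s = t - (t - s) := by ring
    have es' : s' = t' - (t - s) := by linarith
    generalize t - s = w at *
    subst es es'
    nlinarith
  have m1 : |(a - b) * ((a - c) + (b - d))| ≤ (|t - s| / 3) * (|t - t'| / 3 + |t - t'| / 3) := by
    rw [abs_mul]
    exact mul_le_mul l1 ((abs_add_le _ _).trans (add_le_add l2 l3)) (abs_nonneg _) (by positivity)
  have m2 : |(a - b - (c - d)) * (c + d)| ≤ 8 * r * 2 := by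
    rw [abs_mul]
    refine mul_le_mul hg ?_ (abs_nonneg _) ((abs_nonneg _).trans hg)
    rw [abs_of_nonneg (by linarith)]; linarith
  have m3 : 2 * (|t - t'| * |t - s|) ≤ |(a - b) * ((a - c) + (b - d))| + |(a - b - (c - d)) * (c + d)| := by
    have : |2 * ((t - t') * (t - s))| = 2 * (|t - t'| * |t - s|) := by
      rw [abs_mul, abs_mul]; norm_num
    rw [← this, key]
    calc |-((a - b) * ((a - c) + (b - d))) - (a - b - (c - d)) * (c + d)|
        ≤ |-((a - b) * ((a - c) + (b - d)))| + |(a - b - (c - d)) * (c + d)| := abs_sub _ _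
      _ = _ := by rw [abs_neg]
  nlinarith

theorem coord_le_dist (u v : EuclideanSpace ℝ (Fin 2)) (i : Fin 2) : |u i - v i| ≤ dist u v := by
  rw [dist_eq_norm]
  have := PiLp.norm_apply_le (u - v) i
  simpa using this

theorem dist_le_coords (u v : EuclideanSpace ℝ (Fin 2)) :
    dist u v ≤ |u 0 - v 0| + |u 1 - v 1| := by
  rw [EuclideanSpace.dist_eq, Fin.sum_univ_two, Real.dist_eq, Real.dist_eq]
  apply Real.sqrt_le_iff.2
  constructor
  · positivity
  · nlinarith [mul_nonneg (abs_nonneg (u 0 - v 0)) (abs_nonneg (u 1 - v 1))]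

set_option maxHeartbeats 1000000 in
theorem dipole_discrete (A : Set (EuclideanSpace ℝ (Fin 2)))
    (h : Metric.sphere (0 : EuclideanSpace ℝ (Fin 2)) 1 ⊆ A - A) (r : ℝ) (hr : 0 < r)
    (hr' : r ≤ 1 / 200) (S : Finset (EuclideanSpace ℝ (Fin 2)))
    (hS : A ⊆ ⋃ x ∈ S, Metric.ball x r) :
    (1 / (50 * r)) ^ 2 ≤ 32768 * ((Nat.log 2 S.card : ℝ) + 8) ^ 2 *
      ((S.card : ℝ) ^ 3 * √(S.card : ℝ)) := by
  set J := ⌊1 / (40 * r)⌋₊ with hJ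
  have hJle : (J : ℝ) ≤ 1 / (40 * r) := Nat.floor_le (by positivity)
  have hJge : 1 / (40 * r) < J + 1 := Nat.lt_floor_add_one _
  have hJr : (J : ℝ) * r ≤ 1 / 40 := by
    rw [le_div_iff₀ (by positivity)] at hJle; linarith
  have hJr' : 1 / 50 ≤ (J : ℝ) * r := by
    rw [div_lt_iff₀ (by positivity)] at hJge; linarith
  have hJge' : 1 / (50 * r) ≤ J := by
    rw [div_le_iff₀ (by positivity)]; linarith
  have hJ1 : 1 ≤ J := by
    have : (0 : ℝ) < J := lt_of_lt_of_le (by positivity) hJge'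
    exact_mod_cast this
  have ht : ∀ i < J, 0 ≤ 10 * r * (i : ℝ) ∧ 10 * r * (i : ℝ) ≤ 1 / 4 := by
    intro i hi
    have : (i : ℝ) ≤ J := by exact_mod_cast hi.le
    refine ⟨by positivity, ?_⟩
    nlinarith
  have hex : ∀ i : ℕ, ∃ p : EuclideanSpace ℝ (Fin 2) × EuclideanSpace ℝ (Fin 2), i < J →
      p.1 ∈ S ∧ p.2 ∈ S ∧ |(p.2 0 - p.1 0) - √(1 - (10 * r * (i : ℝ)) ^ 2)| ≤ 2 * r ∧
        |(p.2 1 - p.1 1) - 10 * r * (i : ℝ)| ≤ 2 * r := by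
    intro i
    by_cases hi : i < J
    · obtain ⟨t0, t1⟩ := ht i hi
      obtain ⟨g1, g2, g3⟩ := g_facts _ t0 t1
      have hmem : !₂[√(1 - (10 * r * (i : ℝ)) ^ 2), 10 * r * (i : ℝ)] ∈
          Metric.sphere (0 : EuclideanSpace ℝ (Fin 2)) 1 := by
        rw [mem_sphere_zero_iff_norm, EuclideanSpace.norm_eq, Fin.sum_univ_two]
        simp only [Real.norm_eq_abs, sq_abs]
        simpa using g1
      obtain ⟨b, hb, a, ha, hab⟩ := Set.mem_sub.1 (h hmem)
      have h1 := hS hb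
      have h2 := hS ha
      simp only [Set.mem_iUnion, Metric.mem_ball, exists_prop] at h1 h2
      obtain ⟨v, hv, hbv⟩ := h1
      obtain ⟨u, hu, hau⟩ := h2
      refine ⟨(u, v), fun _ => ⟨hu, hv, ?_, ?_⟩⟩
      · have e : b 0 - a 0 = √(1 - (10 * r * (i : ℝ)) ^ 2) := by
          have := congrArg (fun z : EuclideanSpace ℝ (Fin 2) => z 0) hab
          simpa using this
        have q1 := abs_le.1 ((coord_le_dist b v 0).trans hbv.le)
        have q2 := abs_le.1 ((coord_le_dist a u 0).trans hau.le)
        rw [← e, abs_le]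
        constructor <;> simp only <;> linarith [q1.1, q1.2, q2.1, q2.2]
      · have e : b 1 - a 1 = 10 * r * (i : ℝ) := by
          have := congrArg (fun z : EuclideanSpace ℝ (Fin 2) => z 1) hab
          simpa using this
        have q1 := abs_le.1 ((coord_le_dist b v 1).trans hbv.le)
        have q2 := abs_le.1 ((coord_le_dist a u 1).trans hau.le)
        rw [← e, abs_le]
        constructor <;> simp only <;> linarith [q1.1, q1.2, q2.1, q2.2]
    · exact ⟨(0, 0), fun h => absurd h hi⟩
  choose p hp using hex
  have hN : 1 ≤ S.card := Finset.card_pos.2 ⟨_, (hp 0 (by omega)).1⟩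
  have H3 : ∀ i < J, ∀ j < J, ∀ i' < J, ∀ j' < J,
      (∀ c : Fin 2, ((p i).2 c - (p i).1 c) - ((p j).2 c - (p j).1 c) =
        ((p i').2 c - (p i').1 c) - ((p j').2 c - (p j').1 c)) →
      (i : ℤ) - j = i' - j' ∧ |(i : ℝ) - i'| * |(i : ℝ) - j| ≤ 1 / (10 * r) := by
    intro i hi j hj i' hi' j' hj' hc
    obtain ⟨-, -, a1, a2⟩ := hp i hi
    obtain ⟨-, -, b1, b2⟩ := hp j hj
    obtain ⟨-, -, c1, c2⟩ := hp i' hi'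
    obtain ⟨-, -, d1, d2⟩ := hp j' hj'
    have hc0 := hc 0
    have hc1 := hc 1
    have hdiff : (i : ℤ) - j = i' - j' := by
      rw [abs_le] at a2 b2 c2 d2
      have u1 : 10 * r * ((i : ℝ) - j - (i' - j')) ≤ 8 * r := by
        linarith [a2.1, a2.2, b2.1, b2.2, c2.1, c2.2, d2.1, d2.2]
      have u2 : -(8 * r) ≤ 10 * r * ((i : ℝ) - j - (i' - j')) := by
        linarith [a2.1, a2.2, b2.1, b2.2, c2.1, c2.2, d2.1, d2.2]
      have v1 : ((i : ℝ) - j - (i' - j')) < 1 := by nlinarith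
      have v2 : -1 < ((i : ℝ) - j - (i' - j')) := by nlinarith
      have w1 : ((i : ℤ) - j - (i' - j')) < 1 := by exact_mod_cast v1
      have w2 : -1 < ((i : ℤ) - j - (i' - j')) := by exact_mod_cast v2
      omega
    refine ⟨hdiff, ?_⟩
    have hreal : (i : ℝ) - j = i' - j' := by exact_mod_cast hdiff
    have := g_codeg r (10 * r * i) (10 * r * j) (10 * r * i') (10 * r * j')
      (ht i hi).1 (ht i hi).2 (ht j hj).1 (ht j hj).2 (ht i' hi').1 (ht i' hi').2
      (ht j' hj').1 (ht j' hj').2 (by linear_combination 10 * r * hreal)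
      (by
        rw [abs_le] at a1 b1 c1 d1 ⊢
        constructor <;> linarith [a1.1, a1.2, b1.1, b1.2, c1.1, c1.2, d1.1, d1.2])
    rw [← mul_sub, ← mul_sub, abs_mul (10 * r), abs_mul (10 * r), abs_of_pos (by positivity : 0 < 10 * r)] at this
    rw [le_div_iff₀ (by positivity)]
    have : r * (|(i : ℝ) - i'| * |(i : ℝ) - j| * (10 * r)) ≤ r * 1 := by nlinarith
    exact le_of_mul_le_mul_left this hr
  have H2 : ∀ i < J, ∀ j < J, ∀ u v : EuclideanSpace ℝ (Fin 2),
      (∀ c : Fin 2, |u c - v c| = |((p i).2 c - (p i).1 c) - ((p j).2 c - (p j).1 c)|) → (i = j → u = v) →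
      dist u v / (10 * r) ≤ 3 * |(i : ℝ) - j| := by
    intro i hi j hj u v hc huv
    rcases eq_or_ne i j with hij | hij
    · rw [huv hij, dist_self, zero_div]; positivity
    obtain ⟨-, -, a1, a2⟩ := hp i hi
    obtain ⟨-, -, b1, b2⟩ := hp j hj
    have hk : (1 : ℝ) ≤ |(i : ℝ) - j| := by
      have : (1 : ℤ) ≤ |(i : ℤ) - j| := Int.one_le_abs (by omega)
      exact_mod_cast this
    have hl := g_lip (10 * r * i) (10 * r * j) (ht i hi).1 (ht i hi).2 (ht j hj).1 (ht j hj).2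
    rw [← mul_sub, abs_mul, abs_of_pos (by positivity : 0 < 10 * r)] at hl
    rw [div_le_iff₀ (by positivity)]
    refine (dist_le_coords u v).trans ?_
    rw [hc 0, hc 1]
    have m0 : |((p i).2 0 - (p i).1 0) - ((p j).2 0 - (p j).1 0)| ≤ 10 * r * |(i : ℝ) - j| / 3 + 4 * r := by
      rw [abs_le] at a1 b1 hl ⊢
      constructor <;> linarith [a1.1, a1.2, b1.1, b1.2, hl.1, hl.2]
    have m1 : |((p i).2 1 - (p i).1 1) - ((p j).2 1 - (p j).1 1)| ≤ 10 * r * |(i : ℝ) - j| + 4 * r := by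
      have hl : |10 * r * ((i : ℝ) - j)| ≤ 10 * r * |(i : ℝ) - j| := by
        rw [abs_mul, abs_of_pos (by positivity : 0 < 10 * r)]
      rw [abs_le] at a2 b2 hl ⊢
      constructor <;> linarith [a2.1, a2.2, b2.1, b2.2, hl.1, hl.2]
    nlinarith
  have H1 : ∀ i < J, ∀ j < J, |(i : ℝ) - j| ≤
      dist (p i).1 (p j).1 / (10 * r) + dist (p i).2 (p j).2 / (10 * r) + 1 := by
    intro i hi j hj
    obtain ⟨-, -, a1, a2⟩ := hp i hi
    obtain ⟨-, -, b1, b2⟩ := hp j hj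
    have q1 := coord_le_dist (p i).1 (p j).1 1
    have q2 := coord_le_dist (p i).2 (p j).2 1
    have : |10 * r * ((i : ℝ) - j)| ≤ dist (p i).1 (p j).1 + dist (p i).2 (p j).2 + 10 * r := by
      rw [abs_le] at a2 b2 q1 q2 ⊢
      constructor <;> linarith [a2.1, a2.2, b2.1, b2.2, q1.1, q1.2, q2.1, q2.2]
    rw [abs_mul, abs_of_pos (by positivity : 0 < 10 * r)] at this
    have e : dist (p i).1 (p j).1 / (10 * r) + dist (p i).2 (p j).2 / (10 * r) + 1 =
      (dist (p i).1 (p j).1 + dist (p i).2 (p j).2 + 10 * r) / (10 * r) := by field_simp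
    rw [e, le_div_iff₀ (by positivity)]
    linarith
  have main := dipole_comb S (fun u v => dist u v / (10 * r)) (by simp) (by intro u v; simp [dist_comm])
    (by intro u v w; rw [← add_div]; gcongr; exact dist_triangle _ _ _)
    (fun i => (p i).1) (fun i => (p i).2) J (1 / (10 * r)) hN hJ1
    (by rw [le_div_iff₀ (by positivity)]; linarith)
    (by rw [div_le_iff₀ (by positivity)]; linarith)
    (fun i hi => (hp i hi).1) (fun i hi => (hp i hi).2.1) H1
    (by
      intro i hi j hj hy
      refine H2 i hi j hj _ _ ?_ (by rintro rfl; rfl)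
      intro c
      rw [hy, abs_sub_comm]
      congr 1; ring)
    (by
      intro i hi j hj hx
      refine H2 i hi j hj _ _ ?_ (by rintro rfl; rfl)
      intro c
      rw [hx]
      congr 1; ring)
    (by
      intro i hi j hj i' hi' j' hj' h1 h2 h3 h4
      refine H3 i hi j hj i' hi' j' hj' ?_
      intro c
      rw [h1, h2, h3, h4]; ring)
    (by
      intro i hi j hj i' hi' j' hj' h1 h2 h3 h4
      refine H3 i hi j hj i' hi' j' hj' ?_
      intro c
      rw [h1, h2, h3, h4]; ring)
  refine le_trans ?_ main
  gcongr

theorem exists_cover_card {A : Set (EuclideanSpace ℝ (Fin 2))} {r : ℝ}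
    (S₀ : Finset (EuclideanSpace ℝ (Fin 2))) (hS₀ : A ⊆ ⋃ x ∈ S₀, Metric.ball x r) :
    (∃ S : Finset (EuclideanSpace ℝ (Fin 2)), A ⊆ (⋃ x ∈ S, Metric.ball x r) ∧
      S.card = (coverN r A).toNat) ∧ (coverN r A).toNat ≤ S₀.card := by
  have hle : ∀ S : Finset (EuclideanSpace ℝ (Fin 2)), A ⊆ (⋃ x ∈ S, Metric.ball x r) →
      coverN r A ≤ (S.card : ℕ∞) := fun S hS => iInf₂_le S hS
  have htop : coverN r A ≠ ⊤ := ne_top_of_le_ne_top (ENat.natCast_ne_top _) (hle S₀ hS₀)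
  obtain ⟨m, hm⟩ := ENat.ne_top_iff_exists.1 htop
  constructor
  · have hlt : coverN r A < ((m + 1 : ℕ) : ℕ∞) := by
      rw [← hm]; exact_mod_cast Nat.lt_succ_self m
    unfold coverN at hlt
    obtain ⟨S, hlt⟩ := iInf_lt_iff.1 hlt
    obtain ⟨hS, hlt⟩ := iInf_lt_iff.1 hlt
    refine ⟨S, hS, ?_⟩
    have h1 : S.card < m + 1 := by exact_mod_cast hlt
    have h2 := hle S hS
    rw [← hm] at h2 ⊢
    have h3 : m ≤ S.card := by exact_mod_cast h2
    simp only [ENat.toNat_natCast]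
    omega
  · have h2 := hle S₀ hS₀
    rw [← hm] at h2 ⊢
    simp only [ENat.toNat_natCast]
    exact_mod_cast h2

theorem exists_grid_cover (A : Set (EuclideanSpace ℝ (Fin 2))) (R r : ℝ) (hR : 1 ≤ R)
    (hA : ∀ z ∈ A, ‖z‖ ≤ R) (hr : 0 < r) (hr1 : r ≤ 1) :
    ∃ S : Finset (EuclideanSpace ℝ (Fin 2)), A ⊆ (⋃ x ∈ S, Metric.ball x r) ∧
      (S.card : ℝ) ≤ (7 * R / r) ^ 2 := by
  classical
  set n := ⌈2 * R / r⌉₊ with hn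
  have hn1 : 2 * R / r ≤ n := Nat.le_ceil _
  have hn2 : (n : ℝ) < 2 * R / r + 1 := Nat.ceil_lt_add_one (by positivity)
  let I : Finset ℤ := Finset.Icc (-(n : ℤ)) n
  let f : ℤ × ℤ → EuclideanSpace ℝ (Fin 2) := fun q => !₂[(q.1 : ℝ) * (r / 2), (q.2 : ℝ) * (r / 2)]
  have hround : ∀ c : ℝ, |c| ≤ R → round (c / (r / 2)) ∈ I ∧
      |c - (round (c / (r / 2)) : ℝ) * (r / 2)| ≤ r / 4 := by
    intro c hc
    have h1 := abs_sub_round (c / (r / 2))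
    have h2 : |c / (r / 2)| ≤ n := by
      rw [abs_div, abs_of_pos (by positivity : 0 < r / 2)]
      refine le_trans ?_ hn1
      rw [div_le_div_iff₀ (by positivity) hr]
      nlinarith
    constructor
    · rw [abs_le] at h1 h2
      have a1 : (round (c / (r / 2)) : ℝ) < n + 1 := by linarith [h1.1, h1.2, h2.1, h2.2]
      have a2 : -((n : ℝ) + 1) < (round (c / (r / 2)) : ℝ) := by linarith [h1.1, h1.2, h2.1, h2.2]
      have b1 : round (c / (r / 2)) < (n : ℤ) + 1 := by exact_mod_cast a1
      have b2 : -((n : ℤ) + 1) < round (c / (r / 2)) := by exact_mod_cast a2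
      rw [Finset.mem_Icc]
      omega
    · have e : c - (round (c / (r / 2)) : ℝ) * (r / 2) =
          (c / (r / 2) - round (c / (r / 2))) * (r / 2) := by field_simp
      rw [e, abs_mul, abs_of_pos (by positivity : 0 < r / 2)]
      nlinarith
  refine ⟨(I ×ˢ I).image f, ?_, ?_⟩
  · intro z hz
    have hc : ∀ i, |z i| ≤ R := fun i => (by
      have := PiLp.norm_apply_le z i
      rw [Real.norm_eq_abs] at this
      exact this.trans (hA z hz))
    obtain ⟨m0, d0⟩ := hround _ (hc 0)
    obtain ⟨m1, d1⟩ := hround _ (hc 1)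
    simp only [Set.mem_iUnion, Metric.mem_ball, exists_prop]
    refine ⟨f (round (z 0 / (r / 2)), round (z 1 / (r / 2))),
      Finset.mem_image_of_mem f (Finset.mem_product.2 ⟨m0, m1⟩), ?_⟩
    refine lt_of_le_of_lt (dist_le_coords _ _) ?_
    have e0 : (f (round (z 0 / (r / 2)), round (z 1 / (r / 2)))) 0 =
        (round (z 0 / (r / 2)) : ℝ) * (r / 2) := by simp [f]
    have e1 : (f (round (z 0 / (r / 2)), round (z 1 / (r / 2)))) 1 =
        (round (z 1 / (r / 2)) : ℝ) * (r / 2) := by simp [f]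
    rw [e0, e1]
    linarith
  · have h1 : ((I ×ˢ I).image f).card ≤ (2 * n + 1) ^ 2 := by
      refine Finset.card_image_le.trans ?_
      rw [Finset.card_product, Int.card_Icc, sq]
      have : ((n : ℤ) + 1 - -(n : ℤ)).toNat = 2 * n + 1 := by omega
      rw [this]
    have h2 : (((I ×ˢ I).image f).card : ℝ) ≤ (2 * n + 1) ^ 2 := by exact_mod_cast h1
    refine h2.trans ?_
    have h3 : 2 * (n : ℝ) + 1 ≤ 7 * R / r := by
      have : 1 ≤ R / r := by rw [le_div_iff₀ hr]; linarith
      have e1 : 2 * R / r = 2 * (R / r) := by ring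
      have e2 : 7 * R / r = 7 * (R / r) := by ring
      rw [e1] at hn2
      rw [e2]
      linarith
    gcongr

theorem log_ineq (η : ℝ) (hη : 0 < η) : ∃ C' : ℝ, ∀ r : ℝ, 0 < r → ∀ N : ℕ, 1 ≤ N →
    (1 / (50 * r)) ^ 2 ≤ 32768 * ((Nat.log 2 N : ℝ) + 8) ^ 2 * ((N : ℝ) ^ 3 * √(N : ℝ)) →
    2 * Real.log (1 / r) ≤ C' + (7 / 2 + 2 * η) * Real.log N := by
  refine ⟨2 * Real.log 50 + Real.log 32768 + 2 * Real.log (8 + 2 / η), ?_⟩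
  intro r hr N hN h
  have hn1 : (1 : ℝ) ≤ N := by exact_mod_cast hN
  have hn0 : (0 : ℝ) < N := by linarith
  have hlog0 : 0 ≤ Real.log N := Real.log_nonneg hn1
  have hk : (Nat.log 2 N : ℝ) + 8 ≤ (8 + 2 / η) * (N : ℝ) ^ η := by
    have a1 : 2 ^ Nat.log 2 N ≤ N := Nat.pow_log_le_self 2 (by omega)
    have a2 : ((2 : ℝ) ^ Nat.log 2 N) ≤ N := by exact_mod_cast a1
    have a3 := Real.log_le_log (by positivity) a2
    rw [Real.log_pow] at a3
    have a4 := Real.log_two_gt_d9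
    have a5 := Real.log_le_rpow_div hn0.le hη
    have a6 : (1 : ℝ) ≤ (N : ℝ) ^ η := Real.one_le_rpow hn1 hη.le
    have a7 : (0 : ℝ) ≤ Nat.log 2 N := Nat.cast_nonneg _
    have a8 : (Nat.log 2 N : ℝ) ≤ 2 * Real.log N := by nlinarith
    have e : (8 + 2 / η) * (N : ℝ) ^ η = 8 * (N : ℝ) ^ η + 2 * ((N : ℝ) ^ η / η) := by ring
    rw [e]; linarith
  have hκ : (0 : ℝ) < (Nat.log 2 N : ℝ) + 8 := by positivity
  have hlk := Real.log_le_log hκ hk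
  have hc : 0 < 8 + 2 / η := by positivity
  rw [Real.log_mul hc.ne' (by positivity), Real.log_rpow hn0] at hlk
  have h1 := Real.log_le_log (by positivity) h
  rw [Real.log_mul (by positivity) (by positivity), Real.log_mul (by positivity) (by positivity),
    Real.log_mul (by positivity) (by positivity), Real.log_pow, Real.log_pow, Real.log_pow,
    Real.log_sqrt hn0.le] at h1
  have e : (1 / (50 * r)) = (1 / r) / 50 := by field_simp
  rw [e, Real.log_div (by positivity) (by norm_num)] at h1
  push_cast at h1
  linarith

theorem dipole_lower_box_ge_four_sevenths (A : Set (EuclideanSpace ℝ (Fin 2)))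
    (hA : Bornology.IsBounded A)
    (h : Metric.sphere (0 : EuclideanSpace ℝ (Fin 2)) 1 ⊆ A - A) :
    (4 : ℝ) / 7 ≤ lowerBoxDim A := by
  obtain ⟨R₀, hR₀⟩ := hA.exists_norm_le
  set R := max R₀ 1 with hRd
  have hR1 : 1 ≤ R := le_max_right _ _
  have hR : ∀ z ∈ A, ‖z‖ ≤ R := fun z hz => (hR₀ z hz).trans (le_max_left _ _)
  have hAne : A.Nonempty := by
    have hmem : !₂[(1 : ℝ), 0] ∈ Metric.sphere (0 : EuclideanSpace ℝ (Fin 2)) 1 := by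
      rw [mem_sphere_zero_iff_norm, EuclideanSpace.norm_eq, Fin.sum_univ_two]
      simp
    obtain ⟨b, hb, -⟩ := Set.mem_sub.1 (h hmem)
    exact ⟨b, hb⟩
  have hsmall : ∀ ε : ℝ, 0 < ε → ∀ᶠ r : ℝ in 𝓝[>] 0, 0 < r ∧ r ≤ ε := by
    intro ε hε
    filter_upwards [Ioo_mem_nhdsGT hε] with r hr
    exact ⟨hr.1, hr.2.le⟩
  have hN1 : ∀ r : ℝ, 0 < r → r ≤ 1 → 1 ≤ (coverN r A).toNat := by
    intro r hr hr1
    obtain ⟨S₀, hS₀, -⟩ := exists_grid_cover A R r hR1 hR hr hr1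
    obtain ⟨⟨S, hS⟩, -⟩ := exists_cover_card S₀ hS₀
    obtain ⟨hS, hcard⟩ : A ⊆ (⋃ x ∈ S, Metric.ball x r) ∧ S.card = (coverN r A).toNat := hS
    rw [← hcard]
    obtain ⟨z, hz⟩ := hAne
    have := hS hz
    simp only [Set.mem_iUnion, exists_prop] at this
    obtain ⟨s, hs, -⟩ := this
    exact Finset.card_pos.2 ⟨s, hs⟩
  have hbdd : Filter.IsBoundedUnder (· ≤ ·) (𝓝[>] (0 : ℝ))
      (fun r : ℝ => Real.log ((coverN r A).toNat) / Real.log (1 / r)) := by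
    refine ⟨4, ?_⟩
    rw [Filter.eventually_map]
    filter_upwards [hsmall (1 / (7 * R)) (by positivity), hsmall (1 / 2) (by norm_num)] with r h1 h2
    obtain ⟨hr, h1⟩ := h1
    have h2 := h2.2
    obtain ⟨S₀, hS₀, hc⟩ := exists_grid_cover A R r hR1 hR hr (by linarith)
    have h3 := (exists_cover_card S₀ hS₀).2
    have h4 : ((coverN r A).toNat : ℝ) ≤ (7 * R / r) ^ 2 := le_trans (by exact_mod_cast h3) hc
    have h5 : 7 * R ≤ 1 / r := by
      rw [le_div_iff₀ (by positivity)] at h1 ⊢; linarith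
    have h6 : 7 * R / r ≤ (1 / r) ^ 2 := by
      calc 7 * R / r = 7 * R * (1 / r) := by ring
        _ ≤ (1 / r) * (1 / r) := by gcongr
        _ = _ := by ring
    have h7 : ((coverN r A).toNat : ℝ) ≤ (1 / r) ^ 4 := by
      calc ((coverN r A).toNat : ℝ) ≤ (7 * R / r) ^ 2 := h4
        _ ≤ ((1 / r) ^ 2) ^ 2 := by gcongr
        _ = _ := by ring
    have h8 : (0 : ℝ) < (coverN r A).toNat := by exact_mod_cast hN1 r hr (by linarith)
    have h9 := Real.log_le_log h8 h7
    rw [Real.log_pow] at h9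
    have h10 : 0 < Real.log (1 / r) := Real.log_pos (by rw [lt_div_iff₀ hr]; linarith)
    rw [div_le_iff₀ h10]
    exact_mod_cast h9
  have hcob := hbdd.isCoboundedUnder_ge
  have main : ∀ a : ℝ, 0 < a → a < 4 / 7 → a ≤ lowerBoxDim A := by
    intro a ha ha'
    unfold lowerBoxDim
    refine Filter.le_liminf_of_le hcob ?_
    set η := (2 - 7 * a / 2) / (4 * a) with hη
    have hη0 : 0 < η := div_pos (by linarith) (by linarith)
    have hηa : a * (7 / 2 + 2 * η) = 1 + 7 * a / 4 := by
      rw [hη]; field_simp; ring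
    obtain ⟨C', hC'⟩ := log_ineq η hη0
    have hlim : Filter.Tendsto (fun r : ℝ => Real.log (1 / r)) (𝓝[>] 0) Filter.atTop := by
      simp only [one_div]
      exact Real.tendsto_log_atTop.comp tendsto_inv_nhdsGT_zero
    filter_upwards [hsmall (1 / 200) (by norm_num),
      hlim.eventually_ge_atTop (C' / (1 - 7 * a / 4))] with r h1 h2
    obtain ⟨hr, h1⟩ := h1
    obtain ⟨S₀, hS₀, -⟩ := exists_grid_cover A R r hR1 hR hr (by linarith)
    obtain ⟨⟨S, hS⟩, -⟩ := exists_cover_card S₀ hS₀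
    obtain ⟨hS, hcard⟩ : A ⊆ (⋃ x ∈ S, Metric.ball x r) ∧ S.card = (coverN r A).toNat := hS
    have h3 := dipole_discrete A h r hr h1 S hS
    rw [hcard] at h3
    have h4 := hC' r hr _ (hN1 r hr (by linarith)) h3
    have h10 : 0 < Real.log (1 / r) := Real.log_pos (by rw [lt_div_iff₀ hr]; linarith)
    rw [le_div_iff₀ h10]
    rw [div_le_iff₀ (by linarith)] at h2
    have hpos : 0 < 7 / 2 + 2 * η := by linarith
    have h5 : (7 / 2 + 2 * η) * (a * Real.log (1 / r)) ≤
        (7 / 2 + 2 * η) * Real.log ((coverN r A).toNat) := by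
      calc (7 / 2 + 2 * η) * (a * Real.log (1 / r)) = (1 + 7 * a / 4) * Real.log (1 / r) := by
            rw [← hηa]; ring
        _ ≤ _ := by linarith
    exact le_of_mul_le_mul_left h5 hpos
  refine le_of_forall_pos_le_add fun ε hε => ?_
  have := main (max (4 / 7 - ε) (1 / 7)) (lt_of_lt_of_le (by norm_num) (le_max_right _ _))
    (max_lt (by linarith) (by norm_num))
  linarith [le_max_left (4 / 7 - ε) (1 / 7 : ℝ)]
end
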